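/- Assume F is algebraically closed of characteristic zero. Let V be a finite-dimensional simple left R-module and set K_V = {χ ∈ Hom(G, F^×) : V^{α_χ} is isomorphic to V as an R-module}, a subgroup of Hom(G, F^×). Then V is isomorphic to a simple (ungraded) R-submodule of some finite-dimensional G-graded simple left R-module if and only if the index [Hom(G, F^×) : K_V] is finite. -/

import Mathlib

/-! Common definitions: gradings on algebras and modules, graded simplicity,
homogeneous endomorphisms, graded subfields, and loop modules. -/

noncomputable section

namespace GradedPaper

variable {F : Type*} [Field F]

/-- `ℳ` is a direct sum decomposition of the `F`-vector space `V`: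
every vector is a finite sum of homogeneous components, and such
decompositions are unique (independence). -/
def IsVSDecomp {V ι : Type*} [AddCommGroup V] [Module F V]
    (ℳ : ι → Submodule F V) : Prop :=
  (∀ v : V, ∃ (t : Finset ι) (c : ι → V), (∀ i ∈ t, c i ∈ ℳ i) ∧ v = ∑ i ∈ t, c i) ∧
  (∀ (t : Finset ι) (c : ι → V), (∀ i ∈ t, c i ∈ ℳ i) → ∑ i ∈ t, c i = 0 →
    ∀ i ∈ t, c i = 0)

/-- A `G`-grading on a unital associative `F`-algebra `R`:
`R = ⊕_{g ∈ G} R_g` with `1 ∈ R_0` and `R_g · R_h ⊆ R_{g+h}`.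
(The abelian grading group is written additively.) -/
structure AlgebraGrading (F : Type*) [Field F] (G : Type*) [AddCommGroup G]
    (R : Type*) [Ring R] [Algebra F R] where
  comp : G → Submodule F R
  decomp : IsVSDecomp comp
  one_mem : (1 : R) ∈ comp 0
  mul_mem : ∀ {g h : G} {r s : R}, r ∈ comp g → s ∈ comp h → r * s ∈ comp (g + h)

variable {G : Type*} [AddCommGroup G] {R : Type*} [Ring R] [Algebra F R]

/-- A grading of a left `R`-module `V` by the group `κ`, compatible with the
`G`-grading `𝒜` of `R` along the homomorphism `p : G →+ κ`
(so `R_g · V_k ⊆ V_{p g + k}`).  For `p = id` this is a `G`-graded module;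
for `p : G →+ G ⧸ H` the natural projection, this is a `G/H`-graded module
(for the induced `G/H`-grading of `R`). -/
structure ModuleGrading (𝒜 : AlgebraGrading F G R) {κ : Type*} [AddCommGroup κ]
    (p : G →+ κ) (V : Type*) [AddCommGroup V] [Module F V] [Module R V]
    [IsScalarTower F R V] where
  comp : κ → Submodule F V
  decomp : IsVSDecomp comp
  smul_mem : ∀ {g : G} {k : κ} {r : R} {v : V},
    r ∈ 𝒜.comp g → v ∈ comp k → r • v ∈ comp (p g + k)

/-- `W` is a graded submodule: every element of `W` is a finite sum of
homogeneous elements of `W`. -/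
def IsGradedSubmodule {κ V : Type*} [AddCommGroup V] [Module F V] [Module R V]
    (ℳ : κ → Submodule F V) (W : Submodule R V) : Prop :=
  ∀ w ∈ W, ∃ (t : Finset κ) (c : κ → V),
    (∀ i ∈ t, c i ∈ ℳ i ∧ c i ∈ W) ∧ w = ∑ i ∈ t, c i

/-- The graded module with components `ℳ` is graded simple. -/
def IsGradedSimpleModule (R : Type*) [Ring R] {κ V : Type*} [AddCommGroup V]
    [Module F V] [Module R V] (ℳ : κ → Submodule F V) : Prop :=
  (∃ v : V, v ≠ 0) ∧ ∀ W : Submodule R V, IsGradedSubmodule ℳ W → W = ⊥ ∨ W = ⊤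

/-- An `R`-module endomorphism of `V` is homogeneous of degree `d`. -/
def IsHomogeneousEnd {κ V : Type*} [Add κ] [AddCommGroup V] [Module F V]
    [Module R V] (ℳ : κ → Submodule F V) (d : κ) (f : Module.End R V) : Prop :=
  ∀ ⦃k : κ⦄ ⦃v : V⦄, v ∈ ℳ k → f v ∈ ℳ (k + d)

/-- The degree-`d` homogeneous component of the (graded) centralizer
`C(V) = End_R(V)`. -/
def homogComp {κ V : Type*} [Add κ] [AddCommGroup V] [Module F V] [Module R V]
    [SMulCommClass R F V] (ℳ : κ → Submodule F V) (d : κ) :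
    Submodule F (Module.End R V) where
  carrier := {f | IsHomogeneousEnd ℳ d f}
  add_mem' := fun hf hg k v hv => (ℳ _).add_mem (hf hv) (hg hv)
  zero_mem' := fun k v hv => (ℳ _).zero_mem
  smul_mem' := fun c f hf k v hv => by
    simpa using (ℳ _).smul_mem c (hf hv)

/-- `f` belongs to the graded centralizer: it is a finite sum of homogeneous
`R`-module endomorphisms. -/
def IsInGradedCentralizer {κ V : Type*} [Add κ] [AddCommGroup V] [Module F V]
    [Module R V] (ℳ : κ → Submodule F V) (f : Module.End R V) : Prop :=
  ∃ (t : Finset κ) (c : κ → Module.End R V),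
    (∀ d ∈ t, IsHomogeneousEnd ℳ d (c d)) ∧ f = ∑ d ∈ t, c d

/-- The module `V` is central (Schurian): its centralizer consists of the
scalar multiples of the identity. -/
def IsCentralModule (F : Type*) [Field F] (R V : Type*) [Ring R] [AddCommGroup V]
    [Module F V] [Module R V] : Prop :=
  ∀ f : Module.End R V, ∃ a : F, ∀ v : V, f v = a • v

/-- A graded subfield of a graded algebra with homogeneous components `𝒟`:
a graded unital subalgebra (given by its homogeneous components `comp`)
which is commutative and in which every nonzero homogeneous element is
invertible. -/
structure GradedSubfield {κ : Type*} [AddCommGroup κ] {A : Type*} [Ring A]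
    [Module F A] (𝒟 : κ → Submodule F A) where
  comp : κ → Submodule F A
  le : ∀ k, comp k ≤ 𝒟 k
  one_mem : (1 : A) ∈ comp 0
  mul_mem : ∀ {g h : κ} {a b : A}, a ∈ comp g → b ∈ comp h → a * b ∈ comp (g + h)
  comm : ∀ {g h : κ} {a b : A}, a ∈ comp g → b ∈ comp h → a * b = b * a
  inv_mem : ∀ {g : κ} {a : A}, a ∈ comp g → a ≠ 0 →
    ∃ b ∈ comp (-g), a * b = 1 ∧ b * a = 1

/-- The support of a graded subfield. -/
def GradedSubfield.support {κ : Type*} [AddCommGroup κ] {A : Type*} [Ring A]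
    [Module F A] {𝒟 : κ → Submodule F A} (𝒦 : GradedSubfield 𝒟) : Set κ :=
  {k | 𝒦.comp k ≠ ⊥}

/-- A graded subfield is maximal if the only graded subfield containing it
is itself. -/
def GradedSubfield.IsMaximal {κ : Type*} [AddCommGroup κ] {A : Type*} [Ring A]
    [Module F A] {𝒟 : κ → Submodule F A} (𝒦 : GradedSubfield 𝒟) : Prop :=
  ∀ 𝒦' : GradedSubfield 𝒟, (∀ k, 𝒦.comp k ≤ 𝒦'.comp k) → ∀ k, 𝒦'.comp k = 𝒦.comp k

/-- A graded subfield is isomorphic, as a graded algebra, to the group algebra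
of its support: it has a homogeneous basis `c` (one-dimensional components)
which is multiplicative. -/
def GradedSubfield.IsGroupAlgebraOfSupport {κ : Type*} [AddCommGroup κ]
    {A : Type*} [Ring A] [Module F A] {𝒟 : κ → Submodule F A}
    (𝒦 : GradedSubfield 𝒟) : Prop :=
  ∃ c : κ → A, c 0 = 1 ∧
    (∀ k ∈ 𝒦.support, c k ∈ 𝒦.comp k ∧ c k ≠ 0 ∧ 𝒦.comp k = Submodule.span F {c k}) ∧
    (∀ k₁ ∈ 𝒦.support, ∀ k₂ ∈ 𝒦.support, c (k₁ + k₂) = c k₁ * c k₂)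

section Loop

variable {Q₁ Q₂ : Type*}

/-- The underlying space of the loop module: inside `V ⊗ F[Q₁] ≅ (Q₁ →₀ V)`,
the subspace `⊕_{a ∈ Q₁} V_{s a} ⊗ a` of finitely supported functions `f` with
`f a ∈ V_{s a}`. -/
def LoopSubmodule {V : Type*} [AddCommGroup V] [Module F V] (s : Q₁ → Q₂)
    (ℳ : Q₂ → Submodule F V) : Submodule F (Q₁ →₀ V) where
  carrier := {f | ∀ a : Q₁, f a ∈ ℳ (s a)}
  add_mem' := fun hf hg a => by simpa using (ℳ _).add_mem (hf a) (hg a)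
  zero_mem' := fun a => by simpa using (ℳ _).zero_mem
  smul_mem' := fun c f hf a => by simpa using (ℳ _).smul_mem c (hf a)

/-- The degree-`a` homogeneous component of the loop module. -/
def loopComp {V : Type*} [AddCommGroup V] [Module F V] (s : Q₁ → Q₂)
    (ℳ : Q₂ → Submodule F V) (a : Q₁) : Submodule F ↥(LoopSubmodule s ℳ) where
  carrier := {x | ∀ b : Q₁, b ≠ a → (x : Q₁ →₀ V) b = 0}
  add_mem' := by
    intro x y hx hy b hb
    simp [hx b hb, hy b hb]
  zero_mem' := by intro b hb; simp
  smul_mem' := by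
    intro c x hx b hb
    simp [hx b hb]

/-- The scalar multiplication of a (possibly non-canonical) module structure,
written explicitly. -/
def msmul {S M : Type*} [Semiring S] [AddCommMonoid M] (i : Module S M)
    (r : S) (x : M) : M :=
  @SMul.smul S M i.toDistribMulAction.toMulAction.toSMul r x

/-- `i` is the loop-module `R`-action: a homogeneous element `r ∈ R_g` acts on
`v ⊗ a` by `r • (v ⊗ a) = (r v) ⊗ (p g + a)`; in terms of values of finitely
supported functions, `(r • x) a = r • x (a - p g)`. -/
def IsLoopSMul [AddCommGroup Q₁] (𝒜 : AlgebraGrading F G R) (p : G →+ Q₁)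
    (s : Q₁ → Q₂) {V : Type*} [AddCommGroup V] [Module F V] [Module R V]
    (ℳ : Q₂ → Submodule F V) (i : Module R ↥(LoopSubmodule s ℳ)) : Prop :=
  ∀ {g : G} {r : R}, r ∈ 𝒜.comp g → ∀ (x : ↥(LoopSubmodule s ℳ)) (a : Q₁),
    ((msmul i r x : ↥(LoopSubmodule s ℳ)) : Q₁ →₀ V) a = r • ((x : Q₁ →₀ V) (a - p g))

/-- The right-shift operator `1 ⊗ d` on the loop module:
`v ⊗ a ↦ v ⊗ (a + d)`. -/
def rshiftFun [AddCommGroup Q₁] {V : Type*} [AddCommGroup V] [Module F V]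
    (s : Q₁ → Q₂) (ℳ : Q₂ → Submodule F V) (d : Q₁) (hd : ∀ a, s (a + d) = s a) :
    ↥(LoopSubmodule s ℳ) → ↥(LoopSubmodule s ℳ) :=
  fun x => ⟨Finsupp.equivMapDomain (Equiv.addRight d) (x : Q₁ →₀ V), by
    intro a
    have key : Finsupp.equivMapDomain (Equiv.addRight d) (x : Q₁ →₀ V) a
        = (x : Q₁ →₀ V) (a - d) := by
      rw [Finsupp.equivMapDomain_apply]
      congr 1
      simp [sub_eq_add_neg]
    rw [key]
    have h1 : s (a - d) = s a := by
      have h2 := hd (a - d)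
      rw [show a - d + d = a by abel] at h2
      exact h2.symm
    exact h1 ▸ x.2 (a - d)⟩

end Loop

section Twist

variable (H : AddSubgroup G)

/-- `i` is the `R`-module structure on (the finitely-supported-functions model
`{f : G/H →₀ V | f q ∈ V_q}` of) the `G/H`-graded module `V`, twisted by the
scalar factors `cf`: a homogeneous `r ∈ R_g` acts on `v ∈ V_k` by
`r • v = cf g k • (r v) ∈ V_{ḡ + k}`. -/
def IsTwistedSMul (𝒜 : AlgebraGrading F G R) {V : Type*} [AddCommGroup V]
    [Module F V] [Module R V] (ℳ : G ⧸ H → Submodule F V) (cf : G → G ⧸ H → F)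
    (i : Module R ↥(LoopSubmodule (id : G ⧸ H → G ⧸ H) ℳ)) : Prop :=
  ∀ {g : G} {r : R}, r ∈ 𝒜.comp g → ∀ (x : ↥(LoopSubmodule (id : G ⧸ H → G ⧸ H) ℳ))
    (q : G ⧸ H),
    ((msmul i r x : ↥(LoopSubmodule (id : G ⧸ H → G ⧸ H) ℳ)) : (G ⧸ H) →₀ V) q
      = cf g (q - QuotientAddGroup.mk g) •
          (r • ((x : (G ⧸ H) →₀ V) (q - QuotientAddGroup.mk g)))

end Twist

section Pregrading

/-- A `G`-pregrading of the left `R`-module `V`: a family of subspaces with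
`V = Σ_g V_g` and `R_g · V_h ⊆ V_{g+h}`. -/
def IsPregrading (𝒜 : AlgebraGrading F G R) {V : Type*} [AddCommGroup V]
    [Module F V] [Module R V] (P : G → Submodule F V) : Prop :=
  (⨆ g, P g) = (⊤ : Submodule F V) ∧
  ∀ {g k : G} {r : R} {v : V}, r ∈ 𝒜.comp g → v ∈ P k → r • v ∈ P (g + k)

/-- A pregrading is thin if it admits no proper refinement. -/
def IsThinPregrading (𝒜 : AlgebraGrading F G R) {V : Type*} [AddCommGroup V]
    [Module F V] [Module R V] (P : G → Submodule F V) : Prop :=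
  IsPregrading 𝒜 P ∧
  ∀ P' : G → Submodule F V, IsPregrading 𝒜 P' → (∀ g, P' g ≤ P g) → P' = P

end Pregrading

section Extras

open TensorProduct

variable {G : Type*} [AddCommGroup G] {R : Type*} [Ring R] [Algebra F R]

lemma mk'_add_right_mem (H : AddSubgroup G) (h : ↥H) (a : G) :
    (QuotientAddGroup.mk' H) (a + (h : G)) = (QuotientAddGroup.mk' H) a := by
  simpa using QuotientAddGroup.mk_add_of_mem a h.2

/-- The right-shift operator `1 ⊗ h`, `h ∈ H`, on the loop module `L_π(V)`
(for `π : G → G/H` the natural projection): `v ⊗ g ↦ v ⊗ (g + h)`. -/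
def loopShift (H : AddSubgroup G) {V : Type*} [AddCommGroup V] [Module F V]
    (ℳ : G ⧸ H → Submodule F V) (h : ↥H) :
    ↥(LoopSubmodule (⇑(QuotientAddGroup.mk' H)) ℳ) →
      ↥(LoopSubmodule (⇑(QuotientAddGroup.mk' H)) ℳ) :=
  rshiftFun (⇑(QuotientAddGroup.mk' H)) ℳ (h : G) (mk'_add_right_mem H h)

lemma twist_elt_mem (H : AddSubgroup G) (ξ : G ⧸ H → G)
    (hξ : ∀ q, (QuotientAddGroup.mk' H) (ξ q) = q) (g : G) (k : G ⧸ H) :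
    g + ξ k - ξ ((QuotientAddGroup.mk' H) g + k) ∈ H := by
  have h0 : (QuotientAddGroup.mk' H) (g + ξ k - ξ ((QuotientAddGroup.mk' H) g + k)) = 0 := by
    rw [map_sub, map_add, hξ, hξ]
    abel
  exact (QuotientAddGroup.eq_zero_iff _).mp h0

/-- The scalar factors `χ(g + ξ(k̄) - ξ(ḡ + k̄))` defining the module `V`
twisted by a character `χ` of `H`, relative to the section `ξ` of the natural
projection `π : G → G/H`. -/
def twistFactor (H : AddSubgroup G) (ξ : G ⧸ H → G)
    (hξ : ∀ q, (QuotientAddGroup.mk' H) (ξ q) = q) (χ : AddChar ↥H Fˣ) :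
    G → G ⧸ H → F :=
  fun g k =>
    ((χ ⟨g + ξ k - ξ ((QuotientAddGroup.mk' H) g + k), twist_elt_mem H ξ hξ g k⟩ : Fˣ) : F)

/-- The `G/H`-grading induced on a quotient `W/N` of a `G`-graded module `W`:
the component of degree `ḡ` is the image of `⊕_{h ∈ H} W_{g+h}`. -/
def quotGradeComp {W : Type*} [AddCommGroup W] [Module F W] [Module R W]
    [IsScalarTower F R W] (H : AddSubgroup G) (ℳ : G → Submodule F W)
    (N : Submodule R W) : G ⧸ H → Submodule F (W ⧸ N) :=
  fun q => ⨆ g : {g : G // (QuotientAddGroup.mk' H) g = q},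
    (ℳ (g : G)).map ((N.mkQ).restrictScalars F)

/-- The submodule `W · ker ρ` of `W`, where `ρ` is the homomorphism of unital
algebras `𝓕 → F` determined by `ρ(c_h) = ρ h` on the multiplicative
homogeneous basis `c` of the graded subfield `𝓕 ≅ FH` of the centralizer:
`W · ker ρ = Σ_{h ∈ H} W·(c_h - ρ(h)·1)`. -/
def kerSubmodule {W : Type*} [AddCommGroup W] [Module F W] [Module R W]
    [SMulCommClass R F W] {H : AddSubgroup G} (c : ↥H → Module.End R W)
    (ρ : ↥H → F) : Submodule R W :=
  ⨆ h : ↥H, LinearMap.range (c h - ρ h • (1 : Module.End R W))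

/-- The grading of the coordinate space `ι' → F` with coordinates of degrees
`gdeg`. -/
def coordComp {ι' : Type*} (gdeg : ι' → G) (g : G) : Submodule F (ι' → F) where
  carrier := {x | ∀ i, gdeg i ≠ g → x i = 0}
  add_mem' := fun hx hy i hi => by
    simp only [Pi.add_apply, hx i hi, hy i hi, add_zero]
  zero_mem' := fun i hi => rfl
  smul_mem' := fun a x hx i hi => by
    simp only [Pi.smul_apply, hx i hi, smul_zero]

/-- The natural grading of a tensor product of two graded algebras (or graded
vector spaces): the component of degree `g` is spanned by the products
`a ⊗ b` of homogeneous elements with `deg a + deg b = g`. -/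
def tensorGradeComp {A B : Type*} [AddCommGroup A] [Module F A] [AddCommGroup B]
    [Module F B] (Ac : G → Submodule F A) (Bc : G → Submodule F B) (g : G) :
    Submodule F (A ⊗[F] B) :=
  Submodule.span F {x | ∃ (g₁ g₂ : G) (a : A) (b : B),
    g₁ + g₂ = g ∧ a ∈ Ac g₁ ∧ b ∈ Bc g₂ ∧ x = a ⊗ₜ[F] b}

/-- The action of `r ∈ R` on an `R`-module `V`, viewed as an `F`-linear
endomorphism of `V`; i.e. the representation `R → End_F(V)`. -/
def actionEnd (F : Type*) [Field F] {R V : Type*} [Ring R] [AddCommGroup V]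
    [Module F V] [Module R V] [SMulCommClass R F V] (r : R) : Module.End F V where
  toFun v := r • v
  map_add' := smul_add r
  map_smul' a v := by simpa using smul_comm r a v

end Extras

end GradedPaper

namespace GradedPaper

section Helpers

/-! ### Decompositions and diagonal operators -/

variable {F : Type*} [Field F] {ι V : Type*} [AddCommGroup V] [Module F V]

lemma IsVSDecomp.isInternal [DecidableEq ι] {ℳ : ι → Submodule F V} (h : IsVSDecomp ℳ) :
    DirectSum.IsInternal ℳ := by
  classical
  constructor
  · rw [injective_iff_map_eq_zero]
    intro x hx
    rw [DirectSum.coeAddMonoidHom_eq_dfinsuppSum, DFinsupp.sum] at hx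
    have h2 := h.2 x.support (fun i => (x i : V)) (fun i _ => (x i).2) hx
    ext i
    by_cases hi : i ∈ x.support
    · exact h2 i hi
    · have := DFinsupp.notMem_support_iff.mp hi
      simp [this]
  · intro v
    obtain ⟨t, c, hc, rfl⟩ := h.1 v
    refine ⟨∑ i ∈ t.attach, DirectSum.of (fun i => ℳ i) i.1 ⟨c i.1, hc i.1 i.2⟩, ?_⟩
    rw [map_sum]
    simp only [DirectSum.coeAddMonoidHom_of]
    exact Finset.sum_attach t c

lemma IsVSDecomp.exists_diag {ℳ : ι → Submodule F V} (h : IsVSDecomp ℳ) (c : ι → F) :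
    ∃ φ : V →ₗ[F] V, ∀ i, ∀ v ∈ ℳ i, φ v = c i • v := by
  classical
  let E := LinearEquiv.ofBijective (DirectSum.coeLinearMap ℳ) h.isInternal
  refine ⟨(DirectSum.toModule F ι V (fun i => c i • (ℳ i).subtype)) ∘ₗ E.symm.toLinearMap, ?_⟩
  intro i v hv
  have : E.symm v = DirectSum.lof F ι (fun i => ℳ i) i ⟨v, hv⟩ := by
    rw [LinearEquiv.symm_apply_eq]
    exact (DirectSum.coeLinearMap_lof ℳ i ⟨v, hv⟩).symm
  simp [this]

/-- The diagonal operator acting by `c i` on the component `ℳ i`. -/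
def IsVSDecomp.diag {ℳ : ι → Submodule F V} (h : IsVSDecomp ℳ) (c : ι → F) : V →ₗ[F] V :=
  (h.exists_diag c).choose

lemma IsVSDecomp.diag_apply {ℳ : ι → Submodule F V} (h : IsVSDecomp ℳ) (c : ι → F)
    {i : ι} {v : V} (hv : v ∈ ℳ i) : h.diag c v = c i • v :=
  (h.exists_diag c).choose_spec i v hv

lemma IsVSDecomp.ind {ℳ : ι → Submodule F V} (h : IsVSDecomp ℳ) {P : V → Prop}
    (h0 : P 0) (hadd : ∀ x y, P x → P y → P (x + y)) (hom : ∀ i, ∀ v ∈ ℳ i, P v) (v : V) :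
    P v := by
  classical
  obtain ⟨t, c, hc, rfl⟩ := h.1 v
  induction t using Finset.induction_on with
  | empty => simpa using h0
  | insert a s ha ih =>
    rw [Finset.sum_insert ha]
    exact hadd _ _ (hom a _ (hc a (by simp))) (ih fun i hi => hc i (by simp [hi]))

open Classical in
/-- The projection to the component `ℳ i`. -/
def IsVSDecomp.proj {ℳ : ι → Submodule F V} (h : IsVSDecomp ℳ) (i : ι) : V →ₗ[F] V :=
  h.diag (Pi.single i 1)

lemma IsVSDecomp.proj_self {ℳ : ι → Submodule F V} (h : IsVSDecomp ℳ)
    {i : ι} {v : V} (hv : v ∈ ℳ i) : h.proj i v = v := by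
  rw [proj, h.diag_apply _ hv]; simp

lemma IsVSDecomp.proj_ne {ℳ : ι → Submodule F V} (h : IsVSDecomp ℳ)
    {i j : ι} (hij : j ≠ i) {v : V} (hv : v ∈ ℳ i) : h.proj j v = 0 := by
  rw [proj, h.diag_apply _ hv]; simp [hij.symm]

lemma IsVSDecomp.proj_mem {ℳ : ι → Submodule F V} (h : IsVSDecomp ℳ)
    (i : ι) (v : V) : h.proj i v ∈ ℳ i := by
  refine h.ind (P := fun v => h.proj i v ∈ ℳ i) (by simp) (fun x y hx hy => ?_) ?_ v
  · rw [map_add]; exact add_mem hx hy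
  · intro j v hv
    by_cases hij : i = j
    · subst hij; rwa [h.proj_self hv]
    · rw [h.proj_ne hij hv]; exact zero_mem _

lemma IsVSDecomp.proj_sum {ℳ : ι → Submodule F V} (h : IsVSDecomp ℳ) [DecidableEq ι]
    (t : Finset ι) (c : ι → V) (hc : ∀ i ∈ t, c i ∈ ℳ i) (j : ι) :
    h.proj j (∑ i ∈ t, c i) = if j ∈ t then c j else 0 := by
  rw [map_sum]
  split_ifs with hj
  · rw [Finset.sum_eq_single j]
    · exact h.proj_self (hc j hj)
    · intro i hi hij
      exact h.proj_ne hij.symm (hc i hi)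
    · exact fun h' => absurd hj h'
  · apply Finset.sum_eq_zero
    intro i hi
    exact h.proj_ne (by rintro rfl; exact hj hi) (hc i hi)

lemma IsVSDecomp.exists_sum_proj {ℳ : ι → Submodule F V} (h : IsVSDecomp ℳ) (v : V) :
    ∃ t : Finset ι, v = ∑ i ∈ t, h.proj i v := by
  classical
  obtain ⟨t, c, hc, hv⟩ := h.1 v
  refine ⟨t, ?_⟩
  have : ∀ i ∈ t, h.proj i v = c i := by
    intro i hi
    rw [hv, h.proj_sum t c hc, if_pos hi]
  rw [Finset.sum_congr rfl this, hv]

lemma iSupIndep_of_indep {ℳ : ι → Submodule F V}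
    (h : ∀ (t : Finset ι) (c : ι → V), (∀ i ∈ t, c i ∈ ℳ i) → ∑ i ∈ t, c i = 0 →
      ∀ i ∈ t, c i = 0) : iSupIndep ℳ := by
  classical
  apply iSupIndep_of_dfinsupp_lsum_injective
  rw [injective_iff_map_eq_zero]
  intro x hx
  rw [DFinsupp.lsum_apply_apply, DFinsupp.sumAddHom_apply, DFinsupp.sum] at hx
  have h2 := h x.support (fun i => (x i : V)) (fun i _ => (x i).2) hx
  ext i
  by_cases hi : i ∈ x.support
  · exact h2 i hi
  · have := DFinsupp.notMem_support_iff.mp hi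
    simp [this]

/-! ### Characters separate points -/

lemma exists_char_ne_one {F : Type*} [Field F] [IsAlgClosed F] [CharZero F]
    {G : Type*} [AddCommGroup G] {g : G} (hg : g ≠ 0) : ∃ χ : AddChar G Fˣ, χ g ≠ 1 := by
  classical
  -- a nontrivial unit killed by the order of `g`
  obtain ⟨u, hu1, hu⟩ : ∃ u : Fˣ, u ≠ 1 ∧ u ^ (addOrderOf g) = 1 := by
    by_cases h0 : addOrderOf g = 0
    · refine ⟨Units.mk0 2 two_ne_zero, ?_, by simp [h0]⟩
      intro h
      have := congrArg Units.val h
      simp at this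
    · have : NeZero ((addOrderOf g : ℕ) : F) := ⟨by exact_mod_cast h0⟩
      obtain ⟨ζ, hζ⟩ := HasEnoughRootsOfUnity.exists_primitiveRoot F (addOrderOf g)
      have hz : IsUnit ζ := hζ.isUnit h0
      refine ⟨hz.unit, ?_, ?_⟩
      · intro h
        have h1 : ζ = 1 := by simpa using congrArg Units.val h
        have := hζ.eq_orderOf
        rw [h1, orderOf_one] at this
        exact hg (AddMonoid.addOrderOf_eq_one_iff.mp this)
      · ext; simpa using hζ.pow_eq_one
  have hroot : ∀ {n : ℤ}, n ≠ 0 → Function.Surjective (fun a : Fˣ => a ^ n) := by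
    intro n hn x
    have hnat : n.natAbs ≠ 0 := by simpa using hn
    obtain ⟨z, hz⟩ := IsAlgClosed.exists_pow_nat_eq (x : F) (Nat.pos_of_ne_zero hnat)
    have hz0 : z ≠ 0 := by
      rintro rfl
      rw [zero_pow hnat] at hz
      exact x.ne_zero hz.symm
    have hz1 : (Units.mk0 z hz0) ^ n.natAbs = x := by ext; simpa using hz
    rcases Int.natAbs_eq n with h | h
    · refine ⟨Units.mk0 z hz0, ?_⟩
      change (Units.mk0 z hz0) ^ n = x
      rw [h, zpow_natCast, hz1]
    · refine ⟨(Units.mk0 z hz0)⁻¹, ?_⟩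
      change ((Units.mk0 z hz0)⁻¹) ^ n = x
      rw [h, inv_zpow', neg_neg, zpow_natCast, hz1]
  let _ : DivisibleBy (Additive Fˣ) ℤ :=
    divisibleByOfSMulRightSurj _ _ (fun {n} hn x => by
      obtain ⟨y, hy⟩ := hroot hn x.toMul
      exact ⟨Additive.ofMul y, congrArg Additive.ofMul hy⟩)
  let l : ℤ ⧸ Ideal.span {(addOrderOf g : ℤ)} →ₗ[ℤ] Additive Fˣ :=
    Submodule.liftQSpanSingleton _ (LinearMap.toSpanSingleton ℤ (Additive Fˣ) (Additive.ofMul u))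
      (by simp [← ofMul_pow, hu])
  obtain ⟨c, hc⟩ := (Module.Baer.of_divisible (Additive Fˣ)).extension_property
    (Submodule.subtype (Submodule.span ℤ {g})) Subtype.val_injective
    (l ∘ₗ (CharacterModule.intSpanEquivQuotAddOrderOf g).toLinearMap)
  refine ⟨{ toFun := fun a => (c a).toMul, map_zero_eq_one' := by simp,
            map_add_eq_mul' := fun a b => by simp }, ?_⟩
  intro h
  have h1 := LinearMap.congr_fun hc ⟨g, Submodule.mem_span_singleton_self g⟩
  rw [LinearMap.comp_apply, LinearMap.comp_apply, LinearEquiv.coe_coe,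
    CharacterModule.intSpanEquivQuotAddOrderOf_apply_self, Submodule.liftQSpanSingleton_apply] at h1
  have h2 : (c g).toMul = u := by
    rw [show c g = _ from h1]
    simp
  exact hu1 (h2.symm.trans h)

lemma char_sum_eq_zero {F : Type*} [Field F] [IsAlgClosed F] [CharZero F]
    {G : Type*} [AddCommGroup G] {V : Type*} [AddCommGroup V] [Module F V]
    (t : Finset G) (c : G → V)
    (h : ∀ χ : AddChar G Fˣ, ∑ g ∈ t, ((χ g : Fˣ) : F) • c g = 0) : ∀ g ∈ t, c g = 0 := by
  let ev : G → (AddChar G Fˣ →* F) := fun g =>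
    { toFun := fun χ => ((χ g : Fˣ) : F), map_one' := by simp, map_mul' := fun a b => by simp }
  have hev : Function.Injective ev := by
    intro a b hab
    by_contra hne
    obtain ⟨χ, hχ⟩ := exists_char_ne_one (F := F) (sub_ne_zero.mpr hne)
    apply hχ
    have : χ a = χ b := Units.ext (DFunLike.congr_fun hab χ)
    rw [AddChar.map_sub_eq_div, this, div_self']
  have hli := (linearIndependent_monoidHom (AddChar G Fˣ) F).comp ev hev
  rw [linearIndependent_iff'] at hli
  intro g hg
  rw [← Module.forall_dual_apply_eq_zero_iff F]
  intro l
  refine hli t (fun g => l (c g)) ?_ g hg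
  funext χ
  have := congrArg l (h χ)
  rw [map_sum, map_zero] at this
  rw [Finset.sum_apply, Pi.zero_apply, ← this]
  refine Finset.sum_congr rfl fun i _ => ?_
  rw [map_smul, smul_eq_mul, mul_comm]
  rfl

end Helpers
section Forward

/-! ### From a graded module to finite index -/

variable {F : Type*} [Field F] {G : Type*} [AddCommGroup G] {R : Type*} [Ring R] [Algebra F R]
  {W : Type*} [AddCommGroup W] [Module F W] [Module R W] [IsScalarTower F R W]

lemma smul_comm_scalar (a : F) (r : R) (w : W) : r • (a • w) = a • (r • w) := by
  rw [← algebraMap_smul R a w, ← algebraMap_smul R a (r • w), ← mul_smul, ← mul_smul,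
    Algebra.commutes]

lemma diag_smul {𝒜 : AlgebraGrading F G R} (𝒲 : ModuleGrading 𝒜 (AddMonoidHom.id G) W)
    (χ : AddChar G Fˣ) {g : G} {r : R} (hr : r ∈ 𝒜.comp g) (w : W) :
    𝒲.decomp.diag (fun k => ((χ k : Fˣ) : F)) (r • w) =
      ((χ g : Fˣ) : F) • (r • 𝒲.decomp.diag (fun k => ((χ k : Fˣ) : F)) w) := by
  refine 𝒲.decomp.ind (P := fun w => 𝒲.decomp.diag (fun k => ((χ k : Fˣ) : F)) (r • w) =
      ((χ g : Fˣ) : F) • (r • 𝒲.decomp.diag (fun k => ((χ k : Fˣ) : F)) w)) (by simp) ?_ ?_ w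
  · intro x y hx hy
    rw [smul_add, map_add, hx, hy, map_add, smul_add, smul_add]
  · intro k w hw
    rw [𝒲.decomp.diag_apply _ hw, 𝒲.decomp.diag_apply _ (𝒲.smul_mem hr hw), smul_comm_scalar,
      smul_smul, AddMonoidHom.id_apply, AddChar.map_add_eq_mul, Units.val_mul]

lemma diag_inv {𝒜 : AlgebraGrading F G R} (𝒲 : ModuleGrading 𝒜 (AddMonoidHom.id G) W)
    (χ : AddChar G Fˣ) (w : W) :
    𝒲.decomp.diag (fun k => (((χ k)⁻¹ : Fˣ) : F))
      (𝒲.decomp.diag (fun k => ((χ k : Fˣ) : F)) w) = w := by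
  refine 𝒲.decomp.ind (P := fun w => 𝒲.decomp.diag (fun k => (((χ k)⁻¹ : Fˣ) : F))
      (𝒲.decomp.diag (fun k => ((χ k : Fˣ) : F)) w) = w) (by simp) ?_ ?_ w
  · intro x y hx hy
    rw [map_add, map_add, hx, hy]
  · intro k w hw
    rw [𝒲.decomp.diag_apply _ hw, map_smul, 𝒲.decomp.diag_apply _ hw, smul_smul]
    simp

variable {V : Type*} [AddCommGroup V] [Module F V] [Module R V] [IsScalarTower F R V]

/-- The twisted copy of `V` in `W`. -/
def twistedSub {𝒜 : AlgebraGrading F G R} (𝒲 : ModuleGrading 𝒜 (AddMonoidHom.id G) W)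
    (f : V →ₗ[R] W) (χ : AddChar G Fˣ) : Submodule R W where
  carrier := Set.range fun v => 𝒲.decomp.diag (fun k => ((χ k : Fˣ) : F)) (f v)
  zero_mem' := ⟨0, by simp⟩
  add_mem' := by
    rintro _ _ ⟨a, rfl⟩ ⟨b, rfl⟩
    exact ⟨a + b, by simp⟩
  smul_mem' := by
    rintro r _ ⟨v, rfl⟩
    refine 𝒜.decomp.ind (P := fun r => r • 𝒲.decomp.diag (fun k => ((χ k : Fˣ) : F)) (f v) ∈
      Set.range fun v => 𝒲.decomp.diag (fun k => ((χ k : Fˣ) : F)) (f v)) ⟨0, by simp⟩ ?_ ?_ r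
    · rintro x y ⟨a, ha⟩ ⟨b, hb⟩
      refine ⟨a + b, ?_⟩
      simp only at ha hb
      simp only [map_add, ha, hb, add_smul]
    · intro g r hr
      refine ⟨(((χ g)⁻¹ : Fˣ) : F) • (r • v), ?_⟩
      have h1 : f ((((χ g)⁻¹ : Fˣ) : F) • (r • v)) = (((χ g)⁻¹ : Fˣ) : F) • (r • f v) := by
        rw [← algebraMap_smul R, map_smul, map_smul, algebraMap_smul]
      simp only [h1, map_smul, diag_smul 𝒲 χ hr, smul_smul]
      simp

/-- The bijection from `V` onto its twisted copy. -/
def twistedEquiv {𝒜 : AlgebraGrading F G R} (𝒲 : ModuleGrading 𝒜 (AddMonoidHom.id G) W)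
    (f : V →ₗ[R] W) (hf : Function.Injective f) (χ : AddChar G Fˣ) :
    V ≃+ twistedSub 𝒲 f χ :=
  AddEquiv.ofBijective
    (AddMonoidHom.mk' (fun v => (⟨𝒲.decomp.diag (fun k => ((χ k : Fˣ) : F)) (f v), v, rfl⟩ :
      twistedSub 𝒲 f χ)) (fun a b => by ext; simp))
    ⟨fun a b hab => by
      have h1 : 𝒲.decomp.diag (fun k => ((χ k : Fˣ) : F)) (f a) =
        𝒲.decomp.diag (fun k => ((χ k : Fˣ) : F)) (f b) := congrArg Subtype.val hab
      have h2 := congrArg (𝒲.decomp.diag (fun k => (((χ k)⁻¹ : Fˣ) : F))) h1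
      rw [diag_inv, diag_inv] at h2
      exact hf h2, by
      rintro ⟨_, v, rfl⟩
      exact ⟨v, rfl⟩⟩

lemma twistedEquiv_smul {𝒜 : AlgebraGrading F G R} (𝒲 : ModuleGrading 𝒜 (AddMonoidHom.id G) W)
    (f : V →ₗ[R] W) (hf : Function.Injective f) (χ : AddChar G Fˣ)
    {g : G} {r : R} (hr : r ∈ 𝒜.comp g) (v : V) :
    twistedEquiv 𝒲 f hf χ (r • v) = (χ g : F) • (r • twistedEquiv 𝒲 f hf χ v) := by
  apply Subtype.ext
  change 𝒲.decomp.diag (fun k => ((χ k : Fˣ) : F)) (f (r • v)) =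
    (χ g : F) • (r • 𝒲.decomp.diag (fun k => ((χ k : Fˣ) : F)) (f v))
  rw [map_smul, diag_smul 𝒲 χ hr]

lemma twistedSub_simple {𝒜 : AlgebraGrading F G R} (𝒲 : ModuleGrading 𝒜 (AddMonoidHom.id G) W)
    (f : V →ₗ[R] W) (hf : Function.Injective f) (χ : AddChar G Fˣ) (hV : IsSimpleModule R V) :
    IsSimpleModule R (twistedSub 𝒲 f χ) := by
  let j := twistedEquiv 𝒲 f hf χ
  have hnt : Nontrivial V := IsSimpleModule.nontrivial R V
  have hnt2 : Nontrivial (twistedSub 𝒲 f χ) := j.symm.toEquiv.nontrivial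
  rw [isSimpleModule_iff]
  refine ⟨fun P => ?_⟩
  let Q : Submodule R V :=
    { carrier := {v | j v ∈ P}
      zero_mem' := by simp
      add_mem' := fun {a b} ha hb => by
        simp only [Set.mem_ofPred_eq, map_add] at *
        exact P.add_mem ha hb
      smul_mem' := fun r v hv => by
        simp only [Set.mem_ofPred_eq] at *
        refine 𝒜.decomp.ind (P := fun r => j (r • v) ∈ P) (by simp) ?_ ?_ r
        · intro x y hx hy
          rw [add_smul, map_add]
          exact P.add_mem hx hy
        · intro g r hr
          rw [twistedEquiv_smul 𝒲 f hf χ hr, ← algebraMap_smul R]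
          exact P.smul_mem _ (P.smul_mem _ hv) }
  rcases eq_bot_or_eq_top Q with h | h
  · left
    rw [eq_bot_iff]
    intro x hx
    have : j.symm x ∈ Q := by change j (j.symm x) ∈ P; simpa using hx
    rw [h, Submodule.mem_bot] at this
    simpa using this
  · right
    rw [eq_top_iff]
    intro x _
    have : j.symm x ∈ Q := by rw [h]; trivial
    have h2 : j (j.symm x) ∈ P := this
    simpa using h2

lemma forward {𝒜 : AlgebraGrading F G R} (𝒲 : ModuleGrading 𝒜 (AddMonoidHom.id G) W)
    [FiniteDimensional F W] (f : V →ₗ[R] W) (hf : Function.Injective f)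
    (hV : IsSimpleModule R V) :
    ∃ (n : ℕ) (reps : Fin n → AddChar G Fˣ), ∀ χ : AddChar G Fˣ, ∃ i : Fin n,
      ∃ e : V ≃+ V, ∀ (g : G) (r : R), r ∈ 𝒜.comp g → ∀ v : V,
        e (((((reps i)⁻¹ * χ) g : Fˣ) : F) • (r • v)) = r • e v := by
  classical
  have hN : IsNoetherian R W := isNoetherian_of_tower F inferInstance
  have hs := fun χ => twistedSub_simple 𝒲 f hf χ hV
  let c : AddChar G Fˣ → isotypicComponents R W := fun χ =>
    ⟨isotypicComponent R W (twistedSub 𝒲 f χ), _, hs χ, rfl⟩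
  have hfin : Finite (Set.range c) := inferInstance
  obtain ⟨n, ⟨q⟩⟩ := Finite.exists_equiv_fin (Set.range c)
  refine ⟨n, fun i => (q.symm i).2.choose, fun χ => ⟨q ⟨c χ, χ, rfl⟩, ?_⟩⟩
  set ψ : AddChar G Fˣ := (q.symm (q ⟨c χ, χ, rfl⟩)).2.choose with hψ
  have hc : c ψ = c χ := by
    have := (q.symm (q ⟨c χ, χ, rfl⟩)).2.choose_spec
    rw [← hψ] at this
    rw [this]
    simp
  have hle : twistedSub 𝒲 f ψ ≤ isotypicComponent R W (twistedSub 𝒲 f χ) := by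
    have h1 := Submodule.le_isotypicComponent (twistedSub 𝒲 f ψ)
    have h2 : isotypicComponent R W (twistedSub 𝒲 f ψ) =
      isotypicComponent R W (twistedSub 𝒲 f χ) := congrArg Subtype.val hc
    rwa [h2] at h1
  have := hs χ
  have := hs ψ
  obtain ⟨θ⟩ := isIsotypicOfType_submodule_iff.mp
    (.isotypicComponent R W (twistedSub 𝒲 f χ)) _ hle
  refine ⟨((twistedEquiv 𝒲 f hf ψ).trans θ.toAddEquiv).trans (twistedEquiv 𝒲 f hf χ).symm, ?_⟩
  intro g r hr v
  simp only [AddEquiv.trans_apply]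
  rw [AddEquiv.symm_apply_eq, twistedEquiv_smul 𝒲 f hf χ hr, AddEquiv.apply_symm_apply]
  have h1 : (((ψ⁻¹ * χ) g : Fˣ) : F) • (r • v) = r • ((((ψ⁻¹ * χ) g : Fˣ) : F) • v) := by
    rw [smul_comm_scalar]
  have hsc : ∀ (a : F) (v : V), twistedEquiv 𝒲 f hf ψ (a • v) =
      a • twistedEquiv 𝒲 f hf ψ v := by
    intro a v
    apply Subtype.ext
    change 𝒲.decomp.diag (fun k => ((ψ k : Fˣ) : F)) (f (a • v)) =
      a • 𝒲.decomp.diag (fun k => ((ψ k : Fˣ) : F)) (f v)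
    rw [← map_smul, ← algebraMap_smul R a v, map_smul, algebraMap_smul]
  rw [hsc, twistedEquiv_smul 𝒲 f hf ψ hr, smul_smul]
  have h3 : (((ψ⁻¹ * χ) g : Fˣ) : F) * (ψ g : F) = (χ g : F) := by
    rw [← Units.val_mul, AddChar.mul_apply, AddChar.inv_apply', mul_comm, mul_inv_cancel_left]
  rw [h3, ← algebraMap_smul R (χ g : F), ← algebraMap_smul R (χ g : F)]
  change θ _ = _ • r • θ _
  rw [map_smul, map_smul]

end Forward
section Minimal

/-! ### From a finite-dimensional graded module to a graded simple one -/

universe w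

variable {F : Type*} [Field F] {G : Type*} [AddCommGroup G] {R : Type*} [Ring R] [Algebra F R]
  {V : Type*} [AddCommGroup V] [Module F V] [Module R V] [IsScalarTower F R V]

lemma IsGradedSubmodule.proj_mem {W : Type*} [AddCommGroup W] [Module F W] [Module R W]
    {ℳ : G → Submodule F W} (h : IsVSDecomp ℳ) {N : Submodule R W}
    (hN : IsGradedSubmodule ℳ N) (g : G) {w : W} (hw : w ∈ N) : h.proj g w ∈ N := by
  classical
  obtain ⟨t, c, hc, rfl⟩ := hN w hw
  rw [h.proj_sum t c (fun i hi => (hc i hi).1)]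
  split_ifs with hg
  · exact (hc g hg).2
  · exact zero_mem _

/-- Grading on a graded submodule. -/
def subGrading {𝒜 : AlgebraGrading F G R} {W : Type*} [AddCommGroup W] [Module F W] [Module R W]
    [IsScalarTower F R W] (𝒲 : ModuleGrading 𝒜 (AddMonoidHom.id G) W) (N : Submodule R W)
    (hN : IsGradedSubmodule 𝒲.comp N) : ModuleGrading 𝒜 (AddMonoidHom.id G) N where
  comp g := (𝒲.comp g).comap (N.subtype.restrictScalars F)
  decomp := by
    classical
    refine ⟨?_, ?_⟩
    · rintro ⟨w, hw⟩
      obtain ⟨t, ht⟩ := 𝒲.decomp.exists_sum_proj w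
      refine ⟨t, fun g => ⟨𝒲.decomp.proj g w, hN.proj_mem 𝒲.decomp g hw⟩, ?_, ?_⟩
      · intro i _
        exact 𝒲.decomp.proj_mem i w
      · apply Subtype.ext
        rw [AddSubmonoidClass.coe_finsetSum]
        exact ht
    · intro t c hc h0 i hi
      apply Subtype.ext
      refine 𝒲.decomp.2 t (fun i => (c i : W)) (fun i hi => hc i hi) ?_ i hi
      have := congrArg Subtype.val h0
      rwa [AddSubmonoidClass.coe_finsetSum] at this
  smul_mem := by
    intro g k r v hr hv
    exact 𝒲.smul_mem hr hv

/-- Grading on the quotient by a graded submodule. -/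
def quotGrading {𝒜 : AlgebraGrading F G R} {W : Type*} [AddCommGroup W] [Module F W] [Module R W]
    [IsScalarTower F R W] (𝒲 : ModuleGrading 𝒜 (AddMonoidHom.id G) W) (N : Submodule R W)
    (hN : IsGradedSubmodule 𝒲.comp N) : ModuleGrading 𝒜 (AddMonoidHom.id G) (W ⧸ N) where
  comp g := (𝒲.comp g).map (N.mkQ.restrictScalars F)
  decomp := by
    classical
    refine ⟨?_, ?_⟩
    · intro x
      obtain ⟨w, rfl⟩ := N.mkQ_surjective x
      obtain ⟨t, ht⟩ := 𝒲.decomp.exists_sum_proj w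
      refine ⟨t, fun g => N.mkQ (𝒲.decomp.proj g w), ?_, ?_⟩
      · intro i _
        exact ⟨_, 𝒲.decomp.proj_mem i w, rfl⟩
      · rw [← map_sum, ← ht]
    · intro t c hc h0 i hi
      choose! d hd hdc using hc
      have h1 : N.mkQ (∑ i ∈ t, d i) = 0 := by
        rw [map_sum, ← h0]
        exact Finset.sum_congr rfl fun i hi => hdc i hi
      rw [Submodule.mkQ_apply, Submodule.Quotient.mk_eq_zero] at h1
      have h2 := hN.proj_mem 𝒲.decomp i h1
      rw [𝒲.decomp.proj_sum t d hd, if_pos hi] at h2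
      rw [← hdc i hi]
      exact (Submodule.Quotient.mk_eq_zero N).mpr h2
  smul_mem := by
    rintro g k r _ hr ⟨v, hv, rfl⟩
    exact ⟨r • v, 𝒲.smul_mem hr hv, by simp⟩

lemma exists_graded_simple (𝒜 : AlgebraGrading F G R) (hV : IsSimpleModule R V) (n : ℕ) :
    ∀ (W : Type w) [AddCommGroup W] [Module F W] [Module R W] [IsScalarTower F R W]
      (_ : ModuleGrading 𝒜 (AddMonoidHom.id G) W) [FiniteDimensional F W]
      (f : V →ₗ[R] W), Function.Injective f → Module.finrank F W = n →
    ∃ (W : Type w) (_ : AddCommGroup W) (_ : Module F W)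
        (_ : Module R W) (_ : IsScalarTower F R W)
        (𝒲 : ModuleGrading 𝒜 (AddMonoidHom.id G) W) (_ : FiniteDimensional F W),
      IsGradedSimpleModule R 𝒲.comp ∧ ∃ f : V →ₗ[R] W, Function.Injective f := by
  induction n using Nat.strong_induction_on with
  | _ n ih =>
  intro W _ _ _ _ 𝒲 _ f hf hn
  by_cases hs : IsGradedSimpleModule R 𝒲.comp
  · exact ⟨W, _, _, _, inferInstance, 𝒲, inferInstance, hs, f, hf⟩
  have hnt : Nontrivial V := IsSimpleModule.nontrivial R V
  have hW : ∃ w : W, w ≠ 0 := by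
    obtain ⟨v, hv⟩ := exists_ne (0 : V)
    exact ⟨f v, fun h => hv (hf (by rw [h, map_zero]))⟩
  simp only [IsGradedSimpleModule, hW, true_and, not_forall, not_or] at hs
  obtain ⟨N, hN, hbot, htop⟩ := hs
  have hbot' : N.restrictScalars F ≠ ⊥ := by
    rwa [Ne, Submodule.restrictScalars_eq_bot_iff]
  have htop' : N.restrictScalars F ≠ ⊤ := by
    rwa [Ne, Submodule.restrictScalars_eq_top_iff]
  have hlt1 : Module.finrank F N < n := by
    rw [← hn]
    exact Submodule.finrank_lt (lt_top_iff_ne_top.mpr htop').ne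
  have hfdN : FiniteDimensional F N :=
    inferInstanceAs (FiniteDimensional F (N.restrictScalars F))
  have hfdQ : FiniteDimensional F (W ⧸ N) :=
    Module.Finite.of_surjective (N.mkQ.restrictScalars F) N.mkQ_surjective
  have hlt2 : Module.finrank F (W ⧸ N) < n := by
    rw [← hn]
    have hker : LinearMap.ker (N.mkQ.restrictScalars F) = N.restrictScalars F := by
      ext x; simp
    have h1 := LinearMap.finrank_range_add_finrank_ker (N.mkQ.restrictScalars F)
    have hrange : LinearMap.range (N.mkQ.restrictScalars F) = ⊤ :=
      LinearMap.range_eq_top.mpr N.mkQ_surjective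
    rw [hrange, finrank_top, hker] at h1
    have h2 : 0 < Module.finrank F (N.restrictScalars F) := by
      rw [Nat.pos_iff_ne_zero]
      exact fun h => hbot' (Submodule.finrank_eq_zero.mp h)
    omega
  rcases LinearMap.injective_or_eq_zero (N.mkQ ∘ₗ f) with h | h
  · exact ih _ hlt2 (W ⧸ N) (quotGrading 𝒲 N hN) (N.mkQ ∘ₗ f) h rfl
  · have hmem : ∀ v, f v ∈ N := by
      intro v
      have := LinearMap.congr_fun h v
      simpa using this
    refine ih _ hlt1 N (subGrading 𝒲 N hN) (f.codRestrict N hmem) ?_ rfl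
    intro a b hab
    exact hf (congrArg Subtype.val hab)

/-- Universe lift of a graded module. -/
def uliftGrading {𝒜 : AlgebraGrading F G R} {W : Type*} [AddCommGroup W] [Module F W] [Module R W]
    [IsScalarTower F R W] (𝒲 : ModuleGrading 𝒜 (AddMonoidHom.id G) W) :
    ModuleGrading 𝒜 (AddMonoidHom.id G) (ULift.{w} W) where
  comp g := (𝒲.comp g).comap (ULift.moduleEquiv (R := F)).toLinearMap
  decomp := by
    refine ⟨?_, ?_⟩
    · rintro ⟨v⟩
      obtain ⟨t, c, hc, rfl⟩ := 𝒲.decomp.1 v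
      refine ⟨t, fun g => ⟨c g⟩, fun i hi => hc i hi, ?_⟩
      apply (ULift.moduleEquiv (R := F)).injective
      rw [map_sum]
      rfl
    · intro t c hc h0 i hi
      apply (ULift.moduleEquiv (R := F)).injective
      rw [map_zero]
      refine 𝒲.decomp.2 t (fun i => ULift.moduleEquiv (R := F) (c i)) hc ?_ i hi
      rw [← map_sum, h0, map_zero]
  smul_mem := by
    intro g k r v hr hv
    exact 𝒲.smul_mem hr hv

end Minimal

section Coinduced

/-! ### The coinduced graded module -/

variable {F : Type*} [Field F] {G : Type*} [AddCommGroup G] {R : Type*} [Ring R] [Algebra F R]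

/-- The largest graded ideal annihilating `V`. -/
def annJ (𝒜 : AlgebraGrading F G R) (V : Type*) [AddCommGroup V] [Module F V] [Module R V]
    [IsScalarTower F R V] : Submodule F R where
  carrier := {x | ∀ (g : G) (v : V), 𝒜.decomp.proj g x • v = 0}
  zero_mem' := by intro g v; simp
  add_mem' := by
    intro a b ha hb g v
    rw [map_add, add_smul, ha g v, hb g v, add_zero]
  smul_mem' := by
    intro a x hx g v
    rw [map_smul, smul_assoc, hx g v, smul_zero]

lemma proj_mul_homog (𝒜 : AlgebraGrading F G R) {h : G} {r : R} (hr : r ∈ 𝒜.comp h) (g : G)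
    (x : R) : 𝒜.decomp.proj g (x * r) = 𝒜.decomp.proj (g - h) x * r := by
  refine 𝒜.decomp.ind (P := fun x => 𝒜.decomp.proj g (x * r) = 𝒜.decomp.proj (g - h) x * r)
    (by simp) ?_ ?_ x
  · intro x y hx hy
    rw [add_mul, map_add, hx, hy, map_add, add_mul]
  · intro k x hx
    by_cases hk : k = g - h
    · subst hk
      rw [𝒜.decomp.proj_self hx, 𝒜.decomp.proj_self]
      simpa using 𝒜.mul_mem hx hr
    · rw [𝒜.decomp.proj_ne (Ne.symm hk) hx, 𝒜.decomp.proj_ne _ (𝒜.mul_mem hx hr), zero_mul]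
      intro h'
      exact hk (by rw [h']; abel)

lemma annJ_mul (𝒜 : AlgebraGrading F G R) (V : Type*) [AddCommGroup V] [Module F V] [Module R V]
    [IsScalarTower F R V] {x : R} (hx : x ∈ annJ 𝒜 V) (r : R) : x * r ∈ annJ 𝒜 V := by
  refine 𝒜.decomp.ind (P := fun r => x * r ∈ annJ 𝒜 V) (by simp) ?_ ?_ r
  · intro a b ha hb
    rw [mul_add]
    exact add_mem ha hb
  · intro h r hr g v
    rw [proj_mul_homog 𝒜 hr, mul_smul]
    exact hx _ _

lemma annJ_proj (𝒜 : AlgebraGrading F G R) (V : Type*) [AddCommGroup V] [Module F V] [Module R V]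
    [IsScalarTower F R V] {x : R} (hx : x ∈ annJ 𝒜 V) (h : G) :
    𝒜.decomp.proj h x ∈ annJ 𝒜 V := by
  intro g v
  by_cases hgh : g = h
  · subst hgh
    rw [𝒜.decomp.proj_self (𝒜.decomp.proj_mem g x)]
    exact hx g v
  · rw [𝒜.decomp.proj_ne hgh (𝒜.decomp.proj_mem h x), zero_smul]

lemma annJ_smul (𝒜 : AlgebraGrading F G R) (V : Type*) [AddCommGroup V] [Module F V] [Module R V]
    [IsScalarTower F R V] {x : R} (hx : x ∈ annJ 𝒜 V) (v : V) : x • v = 0 := by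
  obtain ⟨t, ht⟩ := 𝒜.decomp.exists_sum_proj x
  rw [ht, Finset.sum_smul]
  exact Finset.sum_eq_zero fun i _ => hx i v

/-- Linear maps `R → V` vanishing on `annJ`. -/
def coindSub (𝒜 : AlgebraGrading F G R) (V : Type*) [AddCommGroup V] [Module F V] [Module R V]
    [IsScalarTower F R V] : Submodule F (R →ₗ[F] V) where
  carrier := {f | ∀ x ∈ annJ 𝒜 V, f x = 0}
  zero_mem' := by intro x _; rfl
  add_mem' := by
    intro a b ha hb x hx
    rw [LinearMap.add_apply, ha x hx, hb x hx, add_zero]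
  smul_mem' := by
    intro a f hf x hx
    rw [LinearMap.smul_apply, hf x hx, smul_zero]

/-- The coinduced module. -/
def Coind (𝒜 : AlgebraGrading F G R) (V : Type*) [AddCommGroup V] [Module F V] [Module R V]
    [IsScalarTower F R V] : Type _ := ↥(coindSub 𝒜 V)

variable (𝒜 : AlgebraGrading F G R) (V : Type*) [AddCommGroup V] [Module F V] [Module R V]
    [IsScalarTower F R V]

instance : AddCommGroup (Coind 𝒜 V) := inferInstanceAs (AddCommGroup (coindSub 𝒜 V))

instance : Module F (Coind 𝒜 V) := inferInstanceAs (Module F (coindSub 𝒜 V))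

/-- The underlying linear map. -/
def Coind.fn : Coind 𝒜 V →ₗ[F] (R →ₗ[F] V) := (coindSub 𝒜 V).subtype

variable {𝒜 V}

lemma Coind.ext {f f' : Coind 𝒜 V} (h : ∀ x, Coind.fn 𝒜 V f x = Coind.fn 𝒜 V f' x) : f = f' :=
  Subtype.ext (LinearMap.ext h)

lemma Coind.fn_annJ (f : Coind 𝒜 V) {x : R} (hx : x ∈ annJ 𝒜 V) : Coind.fn 𝒜 V f x = 0 :=
  f.2 x hx

/-- Constructor. -/
def Coind.mk (f : R →ₗ[F] V) (hf : ∀ x ∈ annJ 𝒜 V, f x = 0) : Coind 𝒜 V := ⟨f, hf⟩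

@[simp] lemma Coind.fn_mk (f : R →ₗ[F] V) (hf : ∀ x ∈ annJ 𝒜 V, f x = 0) (x : R) :
    Coind.fn 𝒜 V (Coind.mk f hf) x = f x := rfl

instance : SMul R (Coind 𝒜 V) where
  smul r f := Coind.mk ((Coind.fn 𝒜 V f) ∘ₗ LinearMap.mulRight F r) (fun x hx =>
    f.fn_annJ (annJ_mul 𝒜 V hx r))

@[simp] lemma Coind.fn_smul (r : R) (f : Coind 𝒜 V) (x : R) :
    Coind.fn 𝒜 V (r • f) x = Coind.fn 𝒜 V f (x * r) := rfl

instance : Module R (Coind 𝒜 V) where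
  one_smul f := Coind.ext fun x => by simp
  mul_smul a b f := Coind.ext fun x => by simp [mul_assoc]
  smul_zero a := Coind.ext fun x => by simp
  smul_add a f f' := Coind.ext fun x => by simp
  add_smul a b f := Coind.ext fun x => by simp [mul_add]
  zero_smul f := Coind.ext fun x => by simp

instance : IsScalarTower F R (Coind 𝒜 V) where
  smul_assoc a r f := Coind.ext fun x => by simp

variable (𝒜 V)

lemma Coind.finiteDimensional [FiniteDimensional F V] [FiniteDimensional F (R ⧸ annJ 𝒜 V)] :
    FiniteDimensional F (Coind 𝒜 V) := by
  obtain ⟨C, hC⟩ := (annJ 𝒜 V).exists_isCompl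
  have : FiniteDimensional F C :=
    Module.Finite.equiv (Submodule.quotientEquivOfIsCompl _ _ hC)
  let res : Coind 𝒜 V →ₗ[F] (C →ₗ[F] V) := LinearMap.lcomp F V C.subtype ∘ₗ Coind.fn 𝒜 V
  refine FiniteDimensional.of_injective res ?_
  rw [injective_iff_map_eq_zero]
  intro f hf
  refine Coind.ext fun x => ?_
  have hx : x ∈ annJ 𝒜 V ⊔ C := by rw [hC.sup_eq_top]; trivial
  obtain ⟨y, hy, z, hz, rfl⟩ := Submodule.mem_sup.mp hx
  have h1 : Coind.fn 𝒜 V f z = 0 := LinearMap.congr_fun hf ⟨z, hz⟩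
  rw [map_add, f.fn_annJ hy, h1]
  simp

/-- The homogeneous components of the coinduced module. -/
def Coind.comp (g : G) : Submodule F (Coind 𝒜 V) where
  carrier := {f | ∀ h, h ≠ -g → ∀ x ∈ 𝒜.comp h, Coind.fn 𝒜 V f x = 0}
  zero_mem' := by intro h _ x _; simp
  add_mem' := by
    intro a b ha hb h hh x hx
    simp [ha h hh x hx, hb h hh x hx]
  smul_mem' := by
    intro a f hf h hh x hx
    simp [hf h hh x hx]

lemma Coind.indep (t : Finset G) (c : G → Coind 𝒜 V) (hc : ∀ i ∈ t, c i ∈ Coind.comp 𝒜 V i)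
    (h0 : ∑ i ∈ t, c i = 0) : ∀ i ∈ t, c i = 0 := by
  intro i hi
  refine Coind.ext fun x => ?_
  refine 𝒜.decomp.ind (P := fun x => Coind.fn 𝒜 V (c i) x = Coind.fn 𝒜 V 0 x) (by simp) ?_ ?_ x
  · intro x y hx hy
    rw [map_add, hx, hy, map_add]
  · intro h x hx
    by_cases hh : h = -i
    · subst hh
      rw [← h0, map_sum, LinearMap.sum_apply, Finset.sum_eq_single i]
      · intro j hj hji
        exact hc j hj (-i) (by simpa using hji.symm) x hx
      · exact fun h' => absurd hi h'
    · rw [hc i hi h hh x hx]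
      simp

/-- The coinduced grading. -/
def coindGrading [FiniteDimensional F (Coind 𝒜 V)] :
    ModuleGrading 𝒜 (AddMonoidHom.id G) (Coind 𝒜 V) where
  comp := Coind.comp 𝒜 V
  decomp := by
    classical
    refine ⟨?_, Coind.indep 𝒜 V⟩
    intro f
    have hfin : {g | Coind.comp 𝒜 V g ≠ ⊥}.Finite :=
      WellFoundedGT.finite_ne_bot_of_iSupIndep (iSupIndep_of_indep (Coind.indep 𝒜 V))
    let c : G → Coind 𝒜 V := fun g =>
      Coind.mk (Coind.fn 𝒜 V f ∘ₗ 𝒜.decomp.proj (-g)) (fun x hx =>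
        f.fn_annJ (annJ_proj 𝒜 V hx (-g)))
    have hcfn : ∀ g x, Coind.fn 𝒜 V (c g) x = Coind.fn 𝒜 V f (𝒜.decomp.proj (-g) x) :=
      fun g x => rfl
    have hc : ∀ g, c g ∈ Coind.comp 𝒜 V g := by
      intro g h hh x hx
      rw [hcfn, 𝒜.decomp.proj_ne hh.symm hx, map_zero]
    refine ⟨hfin.toFinset, c, fun i _ => hc i, ?_⟩
    refine Coind.ext fun x => ?_
    refine 𝒜.decomp.ind (P := fun x => Coind.fn 𝒜 V f x =
      Coind.fn 𝒜 V (∑ i ∈ hfin.toFinset, c i) x) (by simp) ?_ ?_ x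
    · intro x y hx hy
      rw [map_add, hx, hy, map_add]
    · intro h x hx
      rw [map_sum, LinearMap.sum_apply]
      have hself : Coind.fn 𝒜 V (c (-h)) x = Coind.fn 𝒜 V f x := by
        rw [hcfn, neg_neg, 𝒜.decomp.proj_self hx]
      rw [Finset.sum_eq_single (-h), hself]
      · intro j _ hj
        exact hc j h (by rintro rfl; simp at hj) x hx
      · intro hn
        have hb : Coind.comp 𝒜 V (-h) = ⊥ := by simpa using hn
        have h0 : c (-h) = 0 := by
          have := hc (-h)
          rwa [hb, Submodule.mem_bot] at this
        rw [h0]; simp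
  smul_mem := by
    intro g k r f hr hf h hh x hx
    rw [Coind.fn_smul]
    refine hf (h + g) ?_ _ (𝒜.mul_mem hx hr)
    intro h'
    apply hh
    rw [AddMonoidHom.id_apply, neg_add_rev, ← h']
    abel

/-- The embedding of `V`. -/
def coindEmb : V →ₗ[R] Coind 𝒜 V where
  toFun v := Coind.mk
    { toFun := fun x => x • v
      map_add' := fun x y => add_smul x y v
      map_smul' := fun a x => smul_assoc a x v } (fun x hx => annJ_smul 𝒜 V hx v)
  map_add' a b := Coind.ext fun x => by simp
  map_smul' r v := Coind.ext fun x => by simp [mul_smul]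

lemma coindEmb_injective : Function.Injective (coindEmb 𝒜 V) := by
  intro a b hab
  have := congrArg (fun f => Coind.fn 𝒜 V f 1) hab
  simpa [coindEmb] using this

lemma annJ_finite [IsAlgClosed F] [CharZero F] [FiniteDimensional F V]
    (H : ∃ (n : ℕ) (reps : Fin n → AddChar G Fˣ), ∀ χ : AddChar G Fˣ, ∃ i : Fin n,
      ∃ e : V ≃+ V, ∀ (g : G) (r : R), r ∈ 𝒜.comp g → ∀ v : V,
        e (((((reps i)⁻¹ * χ) g : Fˣ) : F) • (r • v)) = r • e v) :
    FiniteDimensional F (R ⧸ annJ 𝒜 V) := by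
  obtain ⟨n, reps, H⟩ := H
  let act : R →ₗ[F] Module.End F V := (Algebra.lsmul F F V).toLinearMap
  let Φ : R →ₗ[F] (Fin n → Module.End F V) :=
    LinearMap.pi fun i => act ∘ₗ 𝒜.decomp.diag (fun k => ((reps i k : Fˣ) : F))
  have hΦ : LinearMap.ker Φ ≤ annJ 𝒜 V := by
    intro x hx
    have hx' : ∀ (i : Fin n) (v : V), 𝒜.decomp.diag (fun k => ((reps i k : Fˣ) : F)) x • v = 0 := by
      intro i v
      exact LinearMap.congr_fun (congrFun hx i) v
    have key : ∀ (χ : AddChar G Fˣ) (v : V),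
        𝒜.decomp.diag (fun k => ((χ k : Fˣ) : F)) x • v = 0 := by
      intro χ v
      obtain ⟨i, e, he⟩ := H χ
      have h1 : e (𝒜.decomp.diag (fun k => ((χ k : Fˣ) : F)) x • v) =
          𝒜.decomp.diag (fun k => ((reps i k : Fˣ) : F)) x • e v := by
        refine 𝒜.decomp.ind (P := fun x => e (𝒜.decomp.diag (fun k => ((χ k : Fˣ) : F)) x • v) =
          𝒜.decomp.diag (fun k => ((reps i k : Fˣ) : F)) x • e v) (by simp) ?_ ?_ x
        · intro a b ha hb
          rw [map_add, add_smul, map_add, ha, hb, map_add, add_smul]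
        · intro g r hr
          rw [𝒜.decomp.diag_apply _ hr, 𝒜.decomp.diag_apply _ hr,
            ← he g _ (Submodule.smul_mem _ _ hr) v]
          congr 1
          rw [smul_assoc, smul_assoc, smul_smul, ← Units.val_mul, AddChar.mul_apply,
            AddChar.inv_apply', mul_right_comm, inv_mul_cancel, one_mul]
      rw [hx' i, ← map_zero e] at h1
      exact e.injective h1
    obtain ⟨t, ht⟩ := 𝒜.decomp.exists_sum_proj x
    intro g v
    have h2 : ∀ g ∈ t, 𝒜.decomp.proj g x • v = 0 := by
      refine char_sum_eq_zero (F := F) t (fun g => 𝒜.decomp.proj g x • v) ?_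
      intro χ
      rw [← key χ v]
      conv_rhs => rw [ht]
      rw [map_sum, Finset.sum_smul]
      refine Finset.sum_congr rfl fun i _ => ?_
      rw [𝒜.decomp.diag_apply _ (𝒜.decomp.proj_mem i x), smul_assoc]
    by_cases hg : g ∈ t
    · exact h2 g hg
    · classical
      have h3 := 𝒜.decomp.proj_sum t (fun i => 𝒜.decomp.proj i x)
        (fun i _ => 𝒜.decomp.proj_mem i x) g
      rw [if_neg hg, ← ht] at h3
      rw [h3, zero_smul]
  have hfd : FiniteDimensional F (R ⧸ LinearMap.ker Φ) :=
    Module.Finite.equiv Φ.quotKerEquivRange.symm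
  exact Module.Finite.of_surjective (Submodule.factor hΦ) (Submodule.factor_surjective hΦ)

end Coinduced
universe u₁ u₂ u₃ u₄

/-- `F` algebraically closed of characteristic zero.  A
finite-dimensional simple module `V` embeds into a finite-dimensional
`G`-graded simple module if and only if the inertia subgroup
`K_V = {χ : V^{α_χ} ≅ V}` has finite index in the character group of `G`. -/
theorem statement19 {F : Type u₁} [Field F] [IsAlgClosed F] [CharZero F]
    {G : Type u₂} [AddCommGroup G] {R : Type u₃} [Ring R] [Algebra F R]
    {V : Type u₄} [AddCommGroup V] [Module F V] [Module R V] [IsScalarTower F R V]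
    (𝒜 : AlgebraGrading F G R) [FiniteDimensional F V]
    (hVsimple : IsSimpleModule R V) :
    (∃ (n : ℕ) (reps : Fin n → AddChar G Fˣ), ∀ χ : AddChar G Fˣ, ∃ i : Fin n,
      ∃ e : V ≃+ V, ∀ (g : G) (r : R), r ∈ 𝒜.comp g → ∀ v : V,
        e (((((reps i)⁻¹ * χ) g : Fˣ) : F) • (r • v)) = r • e v)
    ↔
    (∃ (W : Type (max u₁ u₂ u₃ u₄)) (_ : AddCommGroup W) (_ : Module F W)
        (_ : Module R W) (_ : IsScalarTower F R W)
        (𝒲 : ModuleGrading 𝒜 (AddMonoidHom.id G) W) (_ : FiniteDimensional F W),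
      IsGradedSimpleModule R 𝒲.comp ∧ ∃ f : V →ₗ[R] W, Function.Injective f) := by
  constructor
  · intro H
    have hfin := annJ_finite 𝒜 V H
    have hfd := Coind.finiteDimensional 𝒜 V
    have hfd2 : FiniteDimensional F (ULift.{max u₁ u₂ u₃ u₄} (Coind 𝒜 V)) :=
      Module.Finite.equiv (ULift.moduleEquiv (R := F)).symm
    refine exists_graded_simple.{max u₁ u₂ u₃ u₄} 𝒜 hVsimple _
      (ULift.{max u₁ u₂ u₃ u₄} (Coind 𝒜 V)) (uliftGrading (coindGrading 𝒜 V))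
      ((ULift.moduleEquiv (R := R)).symm.toLinearMap ∘ₗ coindEmb 𝒜 V) ?_ rfl
    exact (ULift.moduleEquiv (R := R)).symm.injective.comp (coindEmb_injective 𝒜 V)
  · rintro ⟨W, _, _, _, _, 𝒲, _, _, f, hf⟩
    exact forward 𝒲 f hf hVsimple

end GradedPaper
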